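/- The Wise group G, given by the presentation ⟨a, b, c, s, t ∣ c = ab, ab = ba, c² = s a s⁻¹, c² = t b t⁻¹⟩, has polynomial branching relative to the word length ℓ: there exist κ ≥ 1, δ ≥ 0, a family C = (C_z^r)_{z ∈ G, r ∈ ℕ*} of polynomial growth, where each C_z^r is a set of (κ,δ)-geodesic 3-paths from the identity e to z, a set 𝕋 of triangles in G which is of polynomial growth and which is a retract along C of the set of all triangles of G. -/

import Mathlib

/-! The Wise group `G = ⟨a, b, c, s, t ∣ c = ab, ab = ba, c² = s a s⁻¹, c² = t b t⁻¹⟩`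
has polynomial branching relative to the word length. -/

/-- The five generators of Wise's group. -/
inductive WiseGen | a | b | c | s | t
  deriving DecidableEq

open FreeGroup in
/-- The relators of Wise's presentation: `c = ab`, `ab = ba`, `c² = s a s⁻¹`,
`c² = t b t⁻¹`. -/
def wiseRels : Set (FreeGroup WiseGen) :=
  { of WiseGen.c * (of WiseGen.a * of WiseGen.b)⁻¹,
    (of WiseGen.a * of WiseGen.b) * (of WiseGen.b * of WiseGen.a)⁻¹,
    (of WiseGen.c * of WiseGen.c) * (of WiseGen.s * of WiseGen.a * (of WiseGen.s)⁻¹)⁻¹,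
    (of WiseGen.c * of WiseGen.c) * (of WiseGen.t * of WiseGen.b * (of WiseGen.t)⁻¹)⁻¹ }

/-- Wise's group, given by the presentation
`⟨a, b, c, s, t ∣ c = ab, ab = ba, c² = s a s⁻¹, c² = t b t⁻¹⟩`. -/
abbrev WiseGroup := PresentedGroup wiseRels

/-- The images in `WiseGroup` of the five generators. -/
def wiseGenSet : Set WiseGroup := Set.range (PresentedGroup.of (rels := wiseRels))

/-- The word length `|·|` on the Wise group relative to the generators
`a, b, c, s, t` and their inverses. -/
noncomputable def wiseWordLength (x : WiseGroup) : ℕ :=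
  sInf {n | ∃ w : List WiseGroup, w.length = n ∧
    (∀ g ∈ w, g ∈ wiseGenSet ∨ g⁻¹ ∈ wiseGenSet) ∧ w.prod = x}

namespace WiseGroup

/-- The image of a generator in the Wise group. -/
def gen (y : WiseGen) : WiseGroup := PresentedGroup.of y

theorem gen_c : gen .c = gen .a * gen .b :=
  mul_inv_eq_one.1 (PresentedGroup.one_of_mem (rels := wiseRels) (by simp [wiseRels]))

theorem gen_comm : gen .a * gen .b = gen .b * gen .a :=
  mul_inv_eq_one.1 (PresentedGroup.one_of_mem (rels := wiseRels)
    (x := (FreeGroup.of WiseGen.a * FreeGroup.of WiseGen.b) *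
      (FreeGroup.of WiseGen.b * FreeGroup.of WiseGen.a)⁻¹) (by simp [wiseRels]))

theorem gen_c_sq_eq_conj_s : gen .c * gen .c = gen .s * gen .a * (gen .s)⁻¹ :=
  mul_inv_eq_one.1 (PresentedGroup.one_of_mem (rels := wiseRels)
    (x := (FreeGroup.of WiseGen.c * FreeGroup.of WiseGen.c) *
      (FreeGroup.of WiseGen.s * FreeGroup.of WiseGen.a * (FreeGroup.of WiseGen.s)⁻¹)⁻¹)
    (by simp [wiseRels]))

theorem gen_c_sq_eq_conj_t : gen .c * gen .c = gen .t * gen .b * (gen .t)⁻¹ :=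
  mul_inv_eq_one.1 (PresentedGroup.one_of_mem (rels := wiseRels)
    (x := (FreeGroup.of WiseGen.c * FreeGroup.of WiseGen.c) *
      (FreeGroup.of WiseGen.t * FreeGroup.of WiseGen.b * (FreeGroup.of WiseGen.t)⁻¹)⁻¹)
    (by simp [wiseRels]))

/-- The universal property of the Wise group. -/
theorem exists_hom {H : Type*} [Group H] (f : WiseGen → H) (hc : f .c = f .a * f .b)
    (hab : f .a * f .b = f .b * f .a) (hs : f .c * f .c = f .s * f .a * (f .s)⁻¹)
    (ht : f .c * f .c = f .t * f .b * (f .t)⁻¹) :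
    ∃ φ : WiseGroup →* H, ∀ y, φ (gen y) = f y := by
  have h : ∀ r ∈ wiseRels, FreeGroup.lift f r = 1 := by
    rintro r (rfl | rfl | rfl | rfl) <;>
      simp only [map_mul, map_inv, FreeGroup.lift_apply_of, mul_inv_eq_one] <;> assumption
  exact ⟨PresentedGroup.toGroup h, fun y => PresentedGroup.toGroup.of h⟩

/-! ### Words and word length -/

/-- The generators and their inverses. -/
def IsLetter (y : WiseGroup) : Prop := y ∈ wiseGenSet ∨ y⁻¹ ∈ wiseGenSet

theorem IsLetter.inv {y : WiseGroup} (h : IsLetter y) : IsLetter y⁻¹ := by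
  unfold IsLetter at *
  rw [inv_inv]
  exact h.symm

theorem isLetter_gen (y : WiseGen) : IsLetter (gen y) := Or.inl ⟨y, rfl⟩

theorem IsLetter.exists_gen {y : WiseGroup} (h : IsLetter y) :
    ∃ x : WiseGen, y = gen x ∨ y = (gen x)⁻¹ := by
  rcases h with ⟨x, hx⟩ | ⟨x, hx⟩
  · exact ⟨x, Or.inl hx.symm⟩
  · exact ⟨x, Or.inr (by rw [gen, hx, inv_inv])⟩

theorem exists_list_of_mem_closure {S : Set WiseGroup} {x : WiseGroup}
    (hx : x ∈ Subgroup.closure S) :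
    ∃ l : List WiseGroup, (∀ y ∈ l, y ∈ S ∨ y⁻¹ ∈ S) ∧ l.prod = x := by
  rw [← Subgroup.mem_toSubmonoid, Subgroup.closure_toSubmonoid] at hx
  exact Submonoid.exists_list_of_mem_closure hx

theorem exists_word (g : WiseGroup) :
    ∃ w : List WiseGroup, w.length = wiseWordLength g ∧ (∀ y ∈ w, IsLetter y) ∧ w.prod = g := by
  have hg : g ∈ Subgroup.closure wiseGenSet := by
    rw [wiseGenSet, PresentedGroup.closure_range_of]
    trivial
  obtain ⟨l, hl, hp⟩ := exists_list_of_mem_closure hg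
  exact Nat.sInf_mem (s := {n | ∃ w : List WiseGroup, w.length = n ∧
    (∀ g ∈ w, g ∈ wiseGenSet ∨ g⁻¹ ∈ wiseGenSet) ∧ w.prod = g}) ⟨l.length, l, rfl, hl, hp⟩

theorem wordLength_prod_le {w : List WiseGroup} (hw : ∀ y ∈ w, IsLetter y) :
    wiseWordLength w.prod ≤ w.length :=
  Nat.sInf_le ⟨w, rfl, hw, rfl⟩

theorem wordLength_mul_le (g h : WiseGroup) :
    wiseWordLength (g * h) ≤ wiseWordLength g + wiseWordLength h := by
  obtain ⟨v, hv, hvl, rfl⟩ := exists_word g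
  obtain ⟨w, hw, hwl, rfl⟩ := exists_word h
  rw [← hv, ← hw, ← List.prod_append, ← List.length_append]
  refine wordLength_prod_le fun y hy => ?_
  rcases List.mem_append.1 hy with hy | hy
  exacts [hvl y hy, hwl y hy]

/-- The word read backwards, each letter being inverted. -/
def revWord (w : List WiseGroup) : List WiseGroup := (w.map (·⁻¹)).reverse

theorem prod_revWord (w : List WiseGroup) : (revWord w).prod = w.prod⁻¹ :=
  (List.prod_inv_reverse w).symm

theorem isLetter_revWord {w : List WiseGroup} (hw : ∀ y ∈ w, IsLetter y) :
    ∀ y ∈ revWord w, IsLetter y := by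
  intro y hy
  simp only [revWord, List.mem_reverse, List.mem_map] at hy
  obtain ⟨z, hz, rfl⟩ := hy
  exact (hw z hz).inv

theorem wordLength_inv_le (g : WiseGroup) : wiseWordLength g⁻¹ ≤ wiseWordLength g := by
  obtain ⟨w, hw, hwl, rfl⟩ := exists_word g
  rw [← hw, ← prod_revWord]
  exact (wordLength_prod_le (isLetter_revWord hwl)).trans (by simp [revWord])

theorem wordLength_inv (g : WiseGroup) : wiseWordLength g⁻¹ = wiseWordLength g :=
  (wordLength_inv_le g).antisymm (by simpa using wordLength_inv_le g⁻¹)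

/-- The vertices visited by the path of the Cayley graph that starts at `P` and is labelled
by the word `w`. -/
def trail (P : WiseGroup) : List WiseGroup → List WiseGroup
  | [] => [P]
  | y :: w => P :: trail (P * y) w

theorem length_trail (P : WiseGroup) (w : List WiseGroup) :
    (trail P w).length = w.length + 1 := by
  induction w generalizing P with
  | nil => rfl
  | cons y w ih => simp [trail, ih]

theorem start_mem_trail (P : WiseGroup) (w : List WiseGroup) : P ∈ trail P w := by
  cases w <;> simp [trail]

theorem mem_trail_append {x P : WiseGroup} {v w : List WiseGroup} :
    x ∈ trail P (v ++ w) ↔ x ∈ trail P v ∨ x ∈ trail (P * v.prod) w := by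
  induction v generalizing P with
  | nil =>
    simp only [List.nil_append, trail, List.prod_nil, mul_one, List.mem_singleton]
    exact ⟨Or.inr, fun h => h.elim (fun h => h ▸ start_mem_trail _ _) id⟩
  | cons y v ih => simp [trail, ih, or_assoc, mul_assoc]

theorem mem_trail_iff {x P : WiseGroup} {w : List WiseGroup} :
    x ∈ trail P w ↔ ∃ w₁ w₂, w = w₁ ++ w₂ ∧ P * w₁.prod = x := by
  constructor
  · intro h
    induction w generalizing P with
    | nil =>
      rw [trail, List.mem_singleton] at h
      exact ⟨[], [], rfl, by simp [h]⟩
    | cons y w ih =>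
      rw [trail, List.mem_cons] at h
      rcases h with rfl | h
      · exact ⟨[], y :: w, rfl, by simp⟩
      · obtain ⟨w₁, w₂, rfl, rfl⟩ := ih h
        exact ⟨y :: w₁, w₂, rfl, by simp [mul_assoc]⟩
  · rintro ⟨w₁, w₂, rfl, rfl⟩
    exact mem_trail_append.2 (Or.inr (start_mem_trail _ _))

theorem end_mem_trail (P : WiseGroup) (w : List WiseGroup) : P * w.prod ∈ trail P w :=
  mem_trail_iff.2 ⟨w, [], by simp, rfl⟩

theorem trail_mul (g P : WiseGroup) (w : List WiseGroup) :
    trail (g * P) w = (trail P w).map (g * ·) := by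
  induction w generalizing P with
  | nil => rfl
  | cons y w ih => simp [trail, ← ih, mul_assoc]

theorem mem_trail_revWord {x P : WiseGroup} {w : List WiseGroup} (h : x ∈ trail P w) :
    x ∈ trail (P * w.prod) (revWord w) := by
  obtain ⟨w₁, w₂, rfl, rfl⟩ := mem_trail_iff.1 h
  refine mem_trail_iff.2 ⟨revWord w₂, revWord w₁, by simp [revWord], ?_⟩
  simp [prod_revWord, mul_assoc]

theorem exists_last_visit (p : WiseGroup → Prop) {P : WiseGroup} {w : List WiseGroup}
    (h : ∃ x ∈ trail P w, p x) :
    ∃ w₁ w₂, w = w₁ ++ w₂ ∧ p (P * w₁.prod) ∧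
      ∀ x ∈ trail (P * w₁.prod) w₂, p x → x = P * w₁.prod := by
  induction w generalizing P with
  | nil =>
    obtain ⟨x, hx, hpx⟩ := h
    rw [trail, List.mem_singleton] at hx
    subst hx
    exact ⟨[], [], rfl, by simpa using hpx, by simp [trail]⟩
  | cons y w ih =>
    by_cases h' : ∃ x ∈ trail (P * y) w, p x
    · obtain ⟨w₁, w₂, rfl, hp, hx⟩ := ih h'
      exact ⟨y :: w₁, w₂, rfl, by simpa [mul_assoc] using hp, by simpa [mul_assoc] using hx⟩
    · push Not at h'
      obtain ⟨x, hx, hpx⟩ := h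
      rw [trail, List.mem_cons] at hx
      rcases hx with rfl | hx
      · refine ⟨[], y :: w, rfl, by simpa using hpx, ?_⟩
        intro z hz hpz
        simp only [List.prod_nil, mul_one, trail, List.mem_cons] at hz ⊢
        exact hz.resolve_right fun hz => h' z hz hpz
      · exact absurd hpx (h' x hx)

/-! ### The flat subgroup and its growth -/

/-- The free abelian subgroup generated by `a` and `b`. -/
def flat : Subgroup WiseGroup := Subgroup.closure {gen .a, gen .b}

theorem gen_a_mem : gen .a ∈ flat := Subgroup.subset_closure (by simp)

theorem gen_b_mem : gen .b ∈ flat := Subgroup.subset_closure (by simp)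

theorem gen_c_mem : gen .c ∈ flat := gen_c ▸ mul_mem gen_a_mem gen_b_mem

theorem exists_zpow_of_mem_flat {u : WiseGroup} (hu : u ∈ flat) :
    ∃ m n : ℤ, u = gen .a ^ m * gen .b ^ n := by
  have hab : Commute (gen .a) (gen .b) := gen_comm
  induction hu using Subgroup.closure_induction with
  | mem x hx =>
    rcases hx with rfl | rfl
    · exact ⟨1, 0, by simp⟩
    · exact ⟨0, 1, by simp⟩
  | one => exact ⟨0, 0, by simp⟩
  | mul x y _ _ hx hy =>
    obtain ⟨m, n, rfl⟩ := hx
    obtain ⟨m', n', rfl⟩ := hy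
    refine ⟨m + m', n + n', ?_⟩
    rw [zpow_add, zpow_add]
    have h := ((hab.zpow_zpow m' n).eq)
    simp only [mul_assoc]
    rw [← mul_assoc (gen .b ^ n), ← h, mul_assoc]
  | inv x _ hx =>
    obtain ⟨m, n, rfl⟩ := hx
    exact ⟨-m, -n, by rw [mul_inv_rev, zpow_neg, zpow_neg, ← zpow_neg, ← zpow_neg,
      (hab.zpow_zpow _ _).eq]⟩

theorem mul_comm_of_mem_flat {u v : WiseGroup} (hu : u ∈ flat) (hv : v ∈ flat) :
    u * v = v * u := by
  have hab : Commute (gen .a) (gen .b) := gen_comm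
  obtain ⟨m, n, rfl⟩ := exists_zpow_of_mem_flat hu
  obtain ⟨m', n', rfl⟩ := exists_zpow_of_mem_flat hv
  exact ((((Commute.refl _).zpow_zpow m m').mul_right (hab.zpow_zpow m n')).mul_left
    ((hab.symm.zpow_zpow n m').mul_right ((Commute.refl _).zpow_zpow n n'))).eq

theorem exists_flat_word {u : WiseGroup} (hu : u ∈ flat) :
    ∃ w : List WiseGroup, (∀ y ∈ w, IsLetter y) ∧ (∀ y ∈ w, y ∈ flat) ∧ w.prod = u := by
  obtain ⟨l, hl, hp⟩ := exists_list_of_mem_closure hu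
  refine ⟨l, fun y hy => ?_, fun y hy => ?_, hp⟩
  · rcases hl y hy with (h | h) | (h | h)
    · exact h ▸ isLetter_gen _
    · exact h ▸ isLetter_gen _
    · rw [← inv_inv y, h]; exact (isLetter_gen _).inv
    · rw [← inv_inv y, h]; exact (isLetter_gen _).inv
  · rcases hl y hy with h | h
    · exact Subgroup.subset_closure h
    · exact inv_mem_iff.1 (Subgroup.subset_closure h)

/-- The translation vector of `a` in the action of the Wise group on the Euclidean plane:
it is twice as long as the translation vector `1` of `c`. -/
noncomputable def transA : ℂ := ⟨1 / 2, √15 / 2⟩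

/-- The translation vector of `b` in the action of the Wise group on the Euclidean plane. -/
noncomputable def transB : ℂ := ⟨1 / 2, -(√15 / 2)⟩

theorem norm_transA : ‖transA‖ = 2 := by
  have h : (√15 : ℝ) * √15 = 15 := Real.mul_self_sqrt (by norm_num)
  rw [Complex.norm_def, Complex.normSq_mk, transA, Real.sqrt_eq_iff_mul_self_eq] <;> nlinarith

theorem norm_transB : ‖transB‖ = 2 := by
  have h : (√15 : ℝ) * √15 = 15 := Real.mul_self_sqrt (by norm_num)
  rw [Complex.norm_def, Complex.normSq_mk, transB, Real.sqrt_eq_iff_mul_self_eq] <;> nlinarith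

theorem transA_add_transB : transA + transB = 1 := by
  apply Complex.ext <;> simp [transA, transB]; norm_num

/-- The Wise group acts on the Euclidean plane with `a`, `b` acting by translations and `s`, `t`
acting by rotations. -/
theorem exists_euclidean_action : ∃ φ : WiseGroup →* (ℂ ≃ᵢ ℂ),
    (∀ z, φ (gen .a) z = transA + z) ∧ (∀ z, φ (gen .b) z = transB + z) ∧
    ∀ y, ‖φ (gen y) 0‖ ≤ 2 := by
  have rot : ∀ τ : ℂ, ‖τ‖ = 2 → ∃ ρ : ℂ ≃ᵢ ℂ, ∀ z, ρ z = 2 / τ * z := by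
    intro τ hτ
    refine ⟨(rotation ⟨2 / τ, by simp [Submonoid.unitSphere, hτ]⟩).toIsometryEquiv, fun z => ?_⟩
    exact rotation_apply _ _
  obtain ⟨ρ, hρ⟩ := rot transA norm_transA
  obtain ⟨σ, hσ⟩ := rot transB norm_transB
  have hA : transA ≠ 0 := norm_ne_zero_iff.1 (by rw [norm_transA]; norm_num)
  have hB : transB ≠ 0 := norm_ne_zero_iff.1 (by rw [norm_transB]; norm_num)
  obtain ⟨φ, hφ⟩ := exists_hom (H := ℂ ≃ᵢ ℂ) (fun y => match y with
    | .a => IsometryEquiv.addLeft transA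
    | .b => IsometryEquiv.addLeft transB
    | .c => IsometryEquiv.addLeft 1
    | .s => ρ
    | .t => σ)
    (by ext1 z; simp [← transA_add_transB, add_assoc])
    (by ext1 z; simp [add_left_comm])
    (by
      rw [eq_mul_inv_iff_mul_eq]
      ext1 z
      simp only [IsometryEquiv.mul_apply, hρ, IsometryEquiv.addLeft_apply]
      field_simp
      ring)
    (by
      rw [eq_mul_inv_iff_mul_eq]
      ext1 z
      simp only [IsometryEquiv.mul_apply, hσ, IsometryEquiv.addLeft_apply]
      field_simp
      ring)
  refine ⟨φ, fun z => by simp [hφ], fun z => by simp [hφ], fun y => ?_⟩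
  cases y <;> simp [hφ, hρ, hσ, norm_transA, norm_transB]

theorem flat_ball_bound {m n : ℤ} {r : ℝ}
    (h : (wiseWordLength (gen .a ^ m * gen .b ^ n) : ℝ) ≤ r) :
    |(m : ℝ)| ≤ 4 * r ∧ |(n : ℝ)| ≤ 4 * r := by
  obtain ⟨φ, hA, hB, hφ⟩ := exists_euclidean_action
  have hletter : ∀ y, IsLetter y → ‖φ y 0‖ ≤ 2 := by
    intro y hy
    obtain ⟨x, rfl | rfl⟩ := hy.exists_gen
    · exact hφ x
    · have := (φ (gen x)).symm.dist_eq (φ (gen x) 0) 0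
      rw [IsometryEquiv.symm_apply_apply, dist_zero_left, dist_zero_right] at this
      rw [map_inv]
      refine le_trans (le_of_eq this) ?_
      exact hφ x
  have hword : ∀ w : List WiseGroup, (∀ y ∈ w, IsLetter y) → ‖φ w.prod 0‖ ≤ 2 * w.length := by
    intro w hw
    induction w with
    | nil => simp
    | cons y w ih =>
      have h1 := ih fun z hz => hw z (List.mem_cons_of_mem _ hz)
      have h2 := hletter y (hw y List.mem_cons_self)
      have h3 := dist_triangle (φ y (φ w.prod 0)) (φ y 0) 0
      rw [IsometryEquiv.dist_eq, dist_zero_right, dist_zero_right, dist_zero_right] at h3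
      rw [List.prod_cons, map_mul, IsometryEquiv.mul_apply, List.length_cons]
      push_cast
      linarith
  have hpow : ∀ (τ : ℂ) (g : WiseGroup), (∀ z, φ g z = τ + z) →
      ∀ (k : ℤ) z, φ (g ^ k) z = k * τ + z := by
    intro τ g hg k
    induction k with
    | zero => simp
    | succ k ih =>
      intro z
      rw [zpow_add_one, map_mul, IsometryEquiv.mul_apply, hg, ih]
      push_cast
      ring
    | pred k ih =>
      intro z
      have h' := ih (z - τ)
      rw [← sub_add_cancel (-(k : ℤ)) 1, zpow_add_one, map_mul, IsometryEquiv.mul_apply, hg,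
        add_sub_cancel] at h'
      rw [h']
      push_cast
      ring
  obtain ⟨w, hw, hwl, hp⟩ := exists_word (gen .a ^ m * gen .b ^ n)
  have hle := hword w hwl
  rw [hp, hw, map_mul, IsometryEquiv.mul_apply, hpow _ _ hB, hpow _ _ hA, add_zero] at hle
  have hre := (Complex.abs_re_le_norm _).trans hle
  have him := (Complex.abs_im_le_norm _).trans hle
  simp only [transA, transB, Complex.add_re, Complex.add_im, Complex.mul_re, Complex.mul_im,
    Complex.intCast_re, Complex.intCast_im] at hre him
  have h1 : |(m : ℝ) + n| ≤ 4 * r := by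
    rw [abs_le] at hre ⊢
    constructor <;> linarith
  have h15 : (2 : ℝ) ≤ √15 := Real.le_sqrt_of_sq_le (by norm_num)
  have h2 : |(m : ℝ) - n| ≤ 2 * r := by
    have h3 : |(m : ℝ) - n| * (√15 / 2) ≤ 2 * r := by
      rw [← abs_of_nonneg (show (0 : ℝ) ≤ √15 / 2 by positivity), ← abs_mul]
      refine le_trans (le_of_eq ?_) (him.trans (by linarith))
      congr 1
      ring
    nlinarith [abs_nonneg ((m : ℝ) - n)]
  rw [abs_le] at h1 h2
  rw [abs_le, abs_le]
  refine ⟨⟨?_, ?_⟩, ?_, ?_⟩ <;> linarith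

/-- The flat subgroup has polynomial growth in the word metric of the Wise group. -/
theorem flat_growth (r : ℝ) (hr : 0 ≤ r) :
    {u | u ∈ flat ∧ (wiseWordLength u : ℝ) ≤ r}.Finite ∧
    ({u | u ∈ flat ∧ (wiseWordLength u : ℝ) ≤ r}.ncard : ℝ) ≤ (8 * r + 1) ^ 2 := by
  classical
  set k : ℤ := ⌊4 * r⌋ with hk
  have hk0 : 0 ≤ k := Int.floor_nonneg.2 (by linarith)
  let S : Finset WiseGroup := (Finset.Icc (-k) k ×ˢ Finset.Icc (-k) k).image
    fun p : ℤ × ℤ => gen .a ^ p.1 * gen .b ^ p.2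
  have hsub : {u | u ∈ flat ∧ (wiseWordLength u : ℝ) ≤ r} ⊆ (S : Set WiseGroup) := by
    rintro u ⟨hu, hur⟩
    obtain ⟨m, n, rfl⟩ := exists_zpow_of_mem_flat hu
    obtain ⟨hm, hn⟩ := flat_ball_bound hur
    have aux : ∀ j : ℤ, |(j : ℝ)| ≤ 4 * r → -k ≤ j ∧ j ≤ k := by
      intro j hj
      rw [← abs_le, hk, Int.le_floor]
      exact_mod_cast hj
    simp only [S, Finset.coe_image, Set.mem_image, Finset.mem_coe, Finset.mem_product,
      Finset.mem_Icc]
    exact ⟨(m, n), ⟨aux m hm, aux n hn⟩, rfl⟩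
  refine ⟨S.finite_toSet.subset hsub, ?_⟩
  have h1 : {u | u ∈ flat ∧ (wiseWordLength u : ℝ) ≤ r}.ncard ≤ (2 * k + 1).toNat ^ 2 := by
    refine (Set.ncard_le_ncard hsub S.finite_toSet).trans ?_
    rw [Set.ncard_coe_finset]
    refine Finset.card_image_le.trans (le_of_eq ?_)
    rw [Finset.card_product, Int.card_Icc, sq]
    congr 2 <;> ring
  have h2 : (((2 * k + 1).toNat : ℤ) : ℝ) = 2 * k + 1 := by
    rw [Int.toNat_of_nonneg (by omega)]
    push_cast
    ring
  have h3 : (k : ℝ) ≤ 4 * r := Int.floor_le _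
  have h4 : (0 : ℝ) ≤ k := by exact_mod_cast hk0
  calc _ ≤ ((((2 * k + 1).toNat : ℤ) : ℝ)) ^ 2 := by exact_mod_cast h1
    _ ≤ _ := by rw [h2]; exact pow_le_pow_left₀ (by linarith) (by linarith) 2

/-! ### Separation by cosets of the flat subgroup -/

/-- Cosets of the flat subgroup. -/
abbrev Flats := WiseGroup ⧸ flat

/-- The coset of the flat subgroup through a group element. -/
abbrev toFlat (g : WiseGroup) : Flats := QuotientGroup.mk g

/-- Every path of the Cayley graph from `P` to `Q` meets the coset `V`. -/
def Sep (V : Flats) (P Q : WiseGroup) : Prop :=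
  ∀ w : List WiseGroup, (∀ y ∈ w, IsLetter y) → P * w.prod = Q → ∃ x ∈ trail P w, toFlat x = V

theorem sep_left (P Q : WiseGroup) : Sep (toFlat P) P Q :=
  fun w _ _ => ⟨P, start_mem_trail P w, rfl⟩

theorem Sep.symm {V : Flats} {P Q : WiseGroup} (h : Sep V P Q) : Sep V Q P := by
  rintro w hw rfl
  obtain ⟨x, hx, rfl⟩ := h (revWord w) (isLetter_revWord hw) (by simp [prod_revWord])
  refine ⟨x, ?_, rfl⟩
  have := mem_trail_revWord hx
  rw [prod_revWord, mul_inv_cancel_right] at this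
  simpa [revWord, Function.comp_def] using this

theorem Sep.smul {V : Flats} {P Q : WiseGroup} (h : Sep V P Q) (g : WiseGroup) :
    Sep (g • V) (g * P) (g * Q) := by
  intro w hw hQ
  obtain ⟨x, hx, rfl⟩ := h w hw (by rw [mul_assoc] at hQ; exact mul_left_cancel hQ)
  exact ⟨g * x, by rw [trail_mul]; exact List.mem_map_of_mem hx, rfl⟩

theorem Sep.exists_between {V : Flats} {g : WiseGroup} (h : Sep V 1 g) :
    ∃ N, toFlat N = V ∧ wiseWordLength N + wiseWordLength (N⁻¹ * g) ≤ wiseWordLength g := by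
  obtain ⟨w, hl, hw, rfl⟩ := exists_word g
  obtain ⟨x, hx, hV⟩ := h w hw (one_mul _)
  obtain ⟨w₁, w₂, rfl, rfl⟩ := mem_trail_iff.1 hx
  refine ⟨_, hV, ?_⟩
  rw [← hl, List.length_append, List.prod_append, one_mul, inv_mul_cancel_left]
  exact add_le_add (wordLength_prod_le fun y hy => hw y (List.mem_append_left _ hy))
    (wordLength_prod_le fun y hy => hw y (List.mem_append_right _ hy))

theorem toFlat_of_mem_trail {P x : WiseGroup} {w : List WiseGroup} (hw : ∀ y ∈ w, y ∈ flat)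
    (hx : x ∈ trail P w) : toFlat x = toFlat P := by
  obtain ⟨w₁, w₂, rfl, rfl⟩ := mem_trail_iff.1 hx
  exact QuotientGroup.mk_mul_of_mem P
    (list_prod_mem fun y hy => hw y (List.mem_append_left _ hy))

theorem Sep.of_toFlat_eq {V : Flats} {P P' Q : WiseGroup} (h : Sep V P Q)
    (hP : toFlat P = toFlat P') : Sep V P' Q := by
  obtain ⟨v, hv, hvf, hvp⟩ := exists_flat_word (QuotientGroup.eq.1 hP)
  rintro w hw rfl
  obtain ⟨x, hx, rfl⟩ := h (v ++ w) (fun y hy => (List.mem_append.1 hy).elim (hv y) (hw y))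
    (by rw [List.prod_append, hvp]; group)
  rcases mem_trail_append.1 hx with hx | hx
  · exact ⟨P', start_mem_trail _ _, by rw [toFlat_of_mem_trail hvf hx, hP]⟩
  · rw [hvp, mul_inv_cancel_left] at hx
    exact ⟨x, hx, rfl⟩

theorem Sep.cons {V : Flats} {P y Q : WiseGroup} (h : Sep V P Q) (hy : IsLetter y)
    (hV : toFlat P ≠ V) : Sep V (P * y) Q := by
  rintro w hw rfl
  obtain ⟨x, hx, rfl⟩ := h (y :: w) (by simpa using ⟨hy, hw⟩) (by simp [mul_assoc])
  rw [trail, List.mem_cons] at hx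
  rcases hx with rfl | hx
  · exact absurd rfl hV
  · exact ⟨x, hx, rfl⟩

/-- A cocycle counting the algebraic crossings of a fixed edge of the Bass–Serre tree. -/
theorem exists_crossing_cocycle (x : WiseGen) (hx : x = .s ∨ x = .t) :
    ∃ h : WiseGroup → ℤ, h (gen x)⁻¹ ≠ h 1 ∧ ∀ (g : WiseGroup) (y : WiseGen),
      h (g * (gen y)⁻¹) ≠ h g →
        toFlat g = toFlat 1 ∧ toFlat (g * (gen y)⁻¹) = toFlat (gen x)⁻¹ := by
  classical
  let E : Subgroup WiseGroup := flat ⊓ flat.comap (MulAut.conj (gen x)).toMonoidHom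
  let wt : WiseGen → WiseGroup → ℤ := fun y g => if y = x ∧ g ∈ E then 1 else 0
  let f : WiseGen → Equiv.Perm (WiseGroup × ℤ) := fun y =>
    { toFun := fun p => (gen y * p.1, p.2 + wt y p.1)
      invFun := fun p => ((gen y)⁻¹ * p.1, p.2 - wt y ((gen y)⁻¹ * p.1))
      left_inv := fun p => by simp
      right_inv := fun p => by simp }
  have hf : ∀ y p, f y p = (gen y * p.1, p.2 + wt y p.1) := fun _ _ => rfl
  have hcc : gen .c * gen .c ∈ flat := mul_mem gen_c_mem gen_c_mem
  have hwa : ∀ g, wt .a g = 0 := fun g => if_neg (by rcases hx with rfl | rfl <;> simp)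
  have hwb : ∀ g, wt .b g = 0 := fun g => if_neg (by rcases hx with rfl | rfl <;> simp)
  have hwc : ∀ g, wt .c g = 0 := fun g => if_neg (by rcases hx with rfl | rfl <;> simp)
  have hws : ∀ g, wt .s (gen .a * g) = wt .s g := by
    intro g
    rcases hx with rfl | rfl
    · have ha : gen .a ∈ E := ⟨gen_a_mem, by simpa [gen_c_sq_eq_conj_s] using hcc⟩
      simp only [wt, E.mul_mem_cancel_left ha]
    · simp [wt]
  have hwt : ∀ g, wt .t (gen .b * g) = wt .t g := by
    intro g
    rcases hx with rfl | rfl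
    · simp [wt]
    · have hb : gen .b ∈ E := ⟨gen_b_mem, by simpa [gen_c_sq_eq_conj_t] using hcc⟩
      simp only [wt, E.mul_mem_cancel_left hb]
  obtain ⟨φ, hφ⟩ := exists_hom f
    (by ext1 p; simp [hf, hwa, hwb, hwc, gen_c, mul_assoc])
    (by ext1 p; simp [hf, hwa, hwb, ← mul_assoc, gen_comm])
    (by
      rw [eq_mul_inv_iff_mul_eq]
      ext1 p
      simp only [Equiv.Perm.mul_apply, hf, hwa, hwc, hws, ← mul_assoc, gen_c_sq_eq_conj_s]
      simp)
    (by
      rw [eq_mul_inv_iff_mul_eq]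
      ext1 p
      simp only [Equiv.Perm.mul_apply, hf, hwb, hwc, hwt, ← mul_assoc, gen_c_sq_eq_conj_t]
      simp)
  have hfst : ∀ g p, (φ g p).1 = g * p.1 := by
    intro g p
    obtain ⟨w, -, hw, rfl⟩ := exists_word g
    induction w with
    | nil => simp
    | cons z w ih =>
      rw [List.prod_cons, map_mul, Equiv.Perm.mul_apply, mul_assoc,
        ← ih fun y hy => hw y (List.mem_cons_of_mem _ hy)]
      obtain ⟨v, rfl | rfl⟩ := (hw z List.mem_cons_self).exists_gen
      · rw [hφ, hf]
      · rw [map_inv, hφ]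
        rfl
  have hstep : ∀ g y, (φ (g * (gen y)⁻¹)⁻¹ (1, 0)).2 = (φ g⁻¹ (1, 0)).2 + wt y g⁻¹ := by
    intro g y
    rw [mul_inv_rev, inv_inv, map_mul, Equiv.Perm.mul_apply, hφ, hf, hfst, mul_one]
  refine ⟨fun g => (φ g⁻¹ (1, 0)).2, ?_, fun g y hne => ?_⟩
  · have := hstep 1 x
    rw [one_mul] at this
    simp only [this]
    simp [wt, one_mem]
  · simp only [hstep] at hne
    have hwt' : y = x ∧ g⁻¹ ∈ E := by
      by_contra hcon
      exact hne (by simp only [wt, if_neg hcon, add_zero])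
    obtain ⟨rfl, hE⟩ := hwt'
    have hg : g ∈ E := inv_mem_iff.1 hE
    refine ⟨QuotientGroup.eq.2 (by simpa using hE.1), QuotientGroup.eq.2 ?_⟩
    have := hE.2
    simpa [mul_assoc] using this

/-- Crossing an edge of the Bass–Serre tree. -/
theorem exists_halfspace (P : WiseGroup) {y : WiseGroup} (hy : IsLetter y) (hyf : y ∉ flat) :
    ∃ h : WiseGroup → ℤ, h P ≠ h (P * y) ∧ ∀ g z, IsLetter z → h (g * z) ≠ h g →
      (toFlat g = toFlat P ∧ toFlat (g * z) = toFlat (P * y)) ∨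
      (toFlat g = toFlat (P * y) ∧ toFlat (g * z) = toFlat P) := by
  have main : ∀ (R : WiseGroup) (x : WiseGen), x = .s ∨ x = .t →
      ∃ h : WiseGroup → ℤ, h R ≠ h (R * (gen x)⁻¹) ∧ ∀ g z, IsLetter z → h (g * z) ≠ h g →
        (toFlat g = toFlat R ∧ toFlat (g * z) = toFlat (R * (gen x)⁻¹)) ∨
        (toFlat g = toFlat (R * (gen x)⁻¹) ∧ toFlat (g * z) = toFlat R) := by
    intro R x hx
    obtain ⟨h, hne, hh⟩ := exists_crossing_cocycle x hx
    have htr : ∀ g k, toFlat (R⁻¹ * g) = toFlat k → toFlat g = toFlat (R * k) := by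
      intro g k hgk
      have := congrArg (R • ·) hgk
      simpa [toFlat, ← QuotientGroup.mk_mul] using this
    refine ⟨fun g => h (R⁻¹ * g), by simpa using hne.symm, fun g z hz hgz => ?_⟩
    obtain ⟨v, rfl | rfl⟩ := hz.exists_gen
    · have h1 := hh (R⁻¹ * (g * gen v)) v (by simpa [mul_assoc] using hgz.symm)
      refine Or.inr ⟨htr _ _ ?_, by simpa using htr _ _ h1.1⟩
      simpa [mul_assoc] using h1.2
    · have h1 := hh (R⁻¹ * g) v (by simpa [mul_assoc] using hgz)
      refine Or.inl ⟨by simpa using htr _ _ h1.1, htr _ _ ?_⟩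
      simpa [mul_assoc] using h1.2
  have hst : ∀ x : WiseGen, gen x ∉ flat → x = .s ∨ x = .t := by
    intro x hx
    cases x
    · exact absurd gen_a_mem hx
    · exact absurd gen_b_mem hx
    · exact absurd gen_c_mem hx
    · exact Or.inl rfl
    · exact Or.inr rfl
  obtain ⟨x, rfl | rfl⟩ := hy.exists_gen
  · obtain ⟨h, hne, hh⟩ := main (P * gen x) x (hst x hyf)
    rw [mul_inv_cancel_right] at hne hh
    exact ⟨h, hne.symm, fun g z hz hgz => (hh g z hz hgz).symm⟩
  · exact main P x (hst x (by simpa using hyf))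

theorem halfspace_constant {h : WiseGroup → ℤ} {V : Flats}
    (hV : ∀ g z, IsLetter z → h (g * z) ≠ h g → toFlat g = V ∨ toFlat (g * z) = V)
    {P : WiseGroup} {w : List WiseGroup} (hw : ∀ y ∈ w, IsLetter y)
    (hP : ∀ x ∈ trail P w, toFlat x ≠ V) : h (P * w.prod) = h P := by
  induction w generalizing P with
  | nil => simp
  | cons y w ih =>
    simp only [trail, List.mem_cons, forall_eq_or_imp] at hP hw
    rw [List.prod_cons, ← mul_assoc, ih hw.2 hP.2]
    by_contra hne
    rcases hV P y hw.1 hne with h1 | h1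
    · exact hP.1 h1
    · exact hP.2 _ (start_mem_trail _ _) h1

/-- Every edge of the coset graph is a bridge. -/
theorem sep_or_sep {P y : WiseGroup} (hy : IsLetter y) (hyf : y ∉ flat) (Q : WiseGroup) :
    Sep (toFlat (P * y)) P Q ∨ Sep (toFlat P) (P * y) Q := by
  by_contra hcon
  obtain ⟨h, hne, hh⟩ := exists_halfspace P hy hyf
  simp only [not_or, Sep, not_forall, not_exists, not_and] at hcon
  obtain ⟨⟨v, hv, hvQ, hv'⟩, ⟨w, hw, hwQ, hw'⟩⟩ := hcon
  have h1 := halfspace_constant (h := h) (V := toFlat (P * y))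
    (fun g z hz hgz => by rcases hh g z hz hgz with h | h <;> simp [h]) hv hv'
  have h2 := halfspace_constant (h := h) (V := toFlat P)
    (fun g z hz hgz => by rcases hh g z hz hgz with h | h <;> simp [h]) hw hw'
  rw [hvQ] at h1
  rw [hwQ] at h2
  exact hne (h1.symm.trans h2)

/-- Any three points have a median coset. -/
theorem exists_median (P Q R : WiseGroup) : ∃ V, Sep V P Q ∧ Sep V P R ∧ Sep V Q R := by
  have step : ∀ P y, IsLetter y → (∃ V, Sep V P Q ∧ Sep V P R ∧ Sep V Q R) →
      ∃ V, Sep V (P * y) Q ∧ Sep V (P * y) R ∧ Sep V Q R := by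
    rintro P y hy ⟨V, hPQ, hPR, hQR⟩
    by_cases hV : toFlat P = V
    swap
    · exact ⟨V, hPQ.cons hy hV, hPR.cons hy hV, hQR⟩
    subst hV
    by_cases hyf : y ∈ flat
    · have heq : toFlat P = toFlat (P * y) := (QuotientGroup.mk_mul_of_mem P hyf).symm
      exact ⟨_, hPQ.of_toFlat_eq heq, hPR.of_toFlat_eq heq, hQR⟩
    have back : ∀ {A B}, Sep (toFlat (P * y)) P A → Sep (toFlat P) A B →
        Sep (toFlat (P * y)) A B := by
      rintro A B h1 h2 w hw rfl
      obtain ⟨x, hx, hxP⟩ := h2 w hw rfl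
      obtain ⟨w₁, w₂, rfl, rfl⟩ := mem_trail_iff.1 hx
      obtain ⟨x', hx', hxV⟩ := (h1.of_toFlat_eq hxP.symm).symm w₁
        (fun z hz => hw z (List.mem_append_left _ hz)) rfl
      exact ⟨x', mem_trail_append.2 (Or.inl hx'), hxV⟩
    rcases sep_or_sep hy hyf Q with h1 | h1
    · exact ⟨_, sep_left _ _, sep_left _ _, back h1 hQR⟩
    rcases sep_or_sep hy hyf R with h2 | h2
    · exact ⟨_, sep_left _ _, sep_left _ _, (back h2 hQR.symm).symm⟩
    exact ⟨_, h1, h2, hQR⟩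
  have walk : ∀ (w : List WiseGroup), (∀ y ∈ w, IsLetter y) → ∀ P,
      (∃ V, Sep V P Q ∧ Sep V P R ∧ Sep V Q R) →
      ∃ V, Sep V (P * w.prod) Q ∧ Sep V (P * w.prod) R ∧ Sep V Q R := by
    intro w
    induction w with
    | nil => intro _ P h; simpa using h
    | cons y w ih =>
      intro hw P h
      rw [List.prod_cons, ← mul_assoc]
      exact ih (fun z hz => hw z (List.mem_cons_of_mem _ hz)) _
        (step P y (hw y List.mem_cons_self) h)
  obtain ⟨w, -, hw, hp⟩ := exists_word (Q⁻¹ * P)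
  have := walk w hw Q ⟨_, sep_left _ _, sep_left _ _, sep_left _ _⟩
  rwa [hp, mul_inv_cancel_left] at this

/-! ### Nearest points and the family of 3-paths -/

theorem exists_near (V : Flats) :
    ∃ g, toFlat g = V ∧ ∀ k, toFlat k = V → wiseWordLength g ≤ wiseWordLength k := by
  obtain ⟨g, hg, hmin⟩ := WellFounded.has_min (measure wiseWordLength).wf {g | toFlat g = V}
    (QuotientGroup.mk_surjective V)
  exact ⟨g, hg, fun k hk => not_lt.1 (hmin k hk)⟩

/-- A point of the coset `V` nearest to the identity. -/
noncomputable def near (V : Flats) : WiseGroup := (exists_near V).choose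

theorem toFlat_near (V : Flats) : toFlat (near V) = V := (exists_near V).choose_spec.1

theorem wordLength_near_le (g : WiseGroup) : wiseWordLength (near (toFlat g)) ≤ wiseWordLength g :=
  (exists_near (toFlat g)).choose_spec.2 g rfl

/-- The cosets separating `1` from `g` at distance at most `r` from `1`. -/
def nearSep (g : WiseGroup) (r : ℕ) : Set Flats := {V | Sep V 1 g ∧ wiseWordLength (near V) ≤ r}

theorem nearSep_growth (g : WiseGroup) (r : ℕ) :
    (nearSep g r).Finite ∧ (nearSep g r).ncard ≤ r + 1 := by
  classical
  rcases (nearSep g r).eq_empty_or_nonempty with he | ⟨V₀, hV₀⟩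
  · simp [he]
  obtain ⟨w, -, hw, hp⟩ := exists_word g
  obtain ⟨x₀, hx₀, hxV₀⟩ := hV₀.1 w hw (by rw [hp, one_mul])
  obtain ⟨w₁, w₂, rfl, hF, hlast⟩ := exists_last_visit (fun x => toFlat x ∈ nearSep g r)
    ⟨x₀, hx₀, hxV₀ ▸ hV₀⟩
  rw [one_mul] at hF hlast
  obtain ⟨v, hvl, hv, hvp⟩ := exists_word (near (toFlat w₁.prod))
  obtain ⟨u, hu, huf, hup⟩ := exists_flat_word (QuotientGroup.eq.1 (toFlat_near (toFlat w₁.prod)))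
  have hend : toFlat v.prod = toFlat w₁.prod := by rw [hvp, toFlat_near]
  have hvmem : v.prod ∈ trail 1 v := by simpa using end_mem_trail 1 v
  have hsub : nearSep g r ⊆ (((trail 1 v).toFinset.image toFlat : Finset Flats) : Set Flats) := by
    rintro V hV
    simp only [Finset.coe_image, List.coe_toFinset, Set.mem_image, Set.mem_ofPred_eq]
    obtain ⟨x, hx, hxV⟩ := hV.1 (v ++ (u ++ w₂)) (by
        intro y hy
        simp only [List.mem_append] at hy
        rcases hy with hy | hy | hy
        exacts [hv y hy, hu y hy, hw y (List.mem_append_right _ hy)])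
      (by rw [← hp]; simp [hup, hvp, mul_assoc])
    rcases mem_trail_append.1 hx with hx | hx
    · exact ⟨x, hx, hxV⟩
    refine ⟨_, hvmem, ?_⟩
    rcases mem_trail_append.1 hx with hx | hx
    · rw [← hxV, toFlat_of_mem_trail huf hx, one_mul]
    · rw [hup, hvp, one_mul, mul_inv_cancel_left] at hx
      rw [hend, ← hxV, hlast x hx (hxV ▸ hV)]
  refine ⟨(Finset.finite_toSet _).subset hsub, (Set.ncard_le_ncard hsub
    (Finset.finite_toSet _)).trans ?_⟩
  rw [Set.ncard_coe_finset]
  calc _ ≤ (trail 1 v).toFinset.card := Finset.card_image_le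
    _ ≤ (trail 1 v).length := List.toFinset_card_le _
    _ ≤ r + 1 := by rw [length_trail, hvl]; exact Nat.succ_le_succ hF.2

/-- The 3-path from `1` to `z` through the nearest points of the coset `z • U`. -/
noncomputable def pathThrough (z : WiseGroup) (U : Flats) : WiseGroup × WiseGroup × WiseGroup :=
  (near (z • U), (near (z • U))⁻¹ * z * near U, (near U)⁻¹)

theorem pathThrough_mid_mem_flat (z : WiseGroup) (U : Flats) : (pathThrough z U).2.1 ∈ flat := by
  have : toFlat (near (z • U)) = toFlat (z * near U) := by
    rw [toFlat_near]
    conv_lhs => rw [← toFlat_near U]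
    rfl
  simpa [pathThrough, mul_assoc] using QuotientGroup.eq.1 this

theorem pathThrough_bounds {z : WiseGroup} {U : Flats} (h : Sep U 1 z⁻¹) :
    wiseWordLength (near U) ≤ wiseWordLength z ∧
    wiseWordLength (near (z • U)) ≤ wiseWordLength z ∧
    wiseWordLength (near U)⁻¹ + wiseWordLength (pathThrough z U).2.1 +
      wiseWordLength (near (z • U)) ≤ 3 * wiseWordLength z := by
  obtain ⟨N, rfl, hN⟩ := h.exists_between
  have h1 : wiseWordLength (N⁻¹ * z⁻¹) = wiseWordLength (z * N) := by
    rw [← wordLength_inv (z * N), mul_inv_rev]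
  rw [h1, wordLength_inv] at hN
  have h2 := wordLength_near_le N
  have h3 : wiseWordLength (near (z • toFlat N)) ≤ wiseWordLength (z * N) :=
    wordLength_near_le (z * N)
  have h4 : wiseWordLength (pathThrough z (toFlat N)).2.1 ≤
      wiseWordLength (near (z • toFlat N)) + wiseWordLength (z * N) +
        (wiseWordLength N + wiseWordLength (near (toFlat N))) := by
    have heq : (pathThrough z (toFlat N)).2.1 =
        ((near (z • toFlat N))⁻¹ * (z * N)) * (N⁻¹ * near (toFlat N)) := by
      simp only [pathThrough]
      group
    rw [heq]
    refine (wordLength_mul_le _ _).trans (add_le_add ?_ ?_)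
    · simpa only [wordLength_inv] using wordLength_mul_le (near (z • toFlat N))⁻¹ (z * N)
    · simpa only [wordLength_inv] using wordLength_mul_le N⁻¹ (near (toFlat N))
  rw [wordLength_inv]
  omega

/-- The cosets `U` separating `1` from `z⁻¹` that are close to one of the two ends. -/
def closeSep (z : WiseGroup) (r : ℕ) : Set Flats :=
  {U | Sep U 1 z⁻¹ ∧ (wiseWordLength (near U) ≤ r ∨ wiseWordLength (near (z • U)) ≤ r)}

theorem closeSep_growth (z : WiseGroup) (r : ℕ) :
    (closeSep z r).Finite ∧ (closeSep z r).ncard ≤ 2 * r + 2 := by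
  have hsub : closeSep z r ⊆ nearSep z⁻¹ r ∪ (z⁻¹ • ·) '' nearSep z r := by
    rintro U ⟨hU, h | h⟩
    · exact Or.inl ⟨hU, h⟩
    · refine Or.inr ⟨z • U, ⟨?_, h⟩, inv_smul_smul z U⟩
      simpa using (hU.smul z).symm
  obtain ⟨hf1, hc1⟩ := nearSep_growth z⁻¹ r
  obtain ⟨hf2, hc2⟩ := nearSep_growth z r
  have hf := hf1.union (hf2.image (z⁻¹ • ·))
  refine ⟨hf.subset hsub, (Set.ncard_le_ncard hsub hf).trans ((Set.ncard_union_le _ _).trans ?_)⟩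
  have := Set.ncard_image_le (f := (z⁻¹ • · : Flats → Flats)) hf2
  omega

open Classical in
/-- The 3-paths from `1` to `z` through separating cosets close to one of the two ends. -/
noncomputable def paths (z : WiseGroup) (r : ℕ) : Finset (WiseGroup × WiseGroup × WiseGroup) :=
  (closeSep_growth z r).1.toFinset.image (pathThrough z)

theorem mem_paths {z : WiseGroup} {r : ℕ} {p : WiseGroup × WiseGroup × WiseGroup} :
    p ∈ paths z r ↔ ∃ U ∈ closeSep z r, pathThrough z U = p := by
  simp [paths]

theorem card_paths_le (z : WiseGroup) (r : ℕ) : (paths z r).card ≤ 2 * r + 2 := by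
  obtain ⟨hf, hc⟩ := closeSep_growth z r
  classical
  rw [Set.ncard_eq_toFinset_card _ hf] at hc
  exact Finset.card_image_le.trans hc

/-- The triangles contained in the flat subgroup. -/
def flatTriangles : Set (WiseGroup × WiseGroup × WiseGroup) :=
  {t | t.1 ∈ flat ∧ t.2.1 ∈ flat ∧ t.1 * t.2.1 = t.2.2}

theorem flatTriangles_growth (z : WiseGroup) (r : ℝ) (hr : 0 ≤ r) :
    {t ∈ flatTriangles | t.2.2 = z ∧ (wiseWordLength t.1 : ℝ) ≤ r}.Finite ∧
    ({t ∈ flatTriangles | t.2.2 = z ∧ (wiseWordLength t.1 : ℝ) ≤ r}.ncard : ℝ) ≤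
      (8 * r + 1) ^ 2 := by
  obtain ⟨hf, hc⟩ := flat_growth r hr
  have hsub : {t ∈ flatTriangles | t.2.2 = z ∧ (wiseWordLength t.1 : ℝ) ≤ r} ⊆
      (fun u => (u, u⁻¹ * z, z)) '' {u | u ∈ flat ∧ (wiseWordLength u : ℝ) ≤ r} := by
    rintro ⟨u, v, w⟩ ⟨⟨hu, -, huv⟩, hz, hur⟩
    dsimp only at hu huv hz hur
    subst hz huv
    exact ⟨u, ⟨hu, hur⟩, by simp⟩
  refine ⟨(hf.image _).subset hsub, le_trans ?_ hc⟩
  exact_mod_cast (Set.ncard_le_ncard hsub (hf.image _)).trans (Set.ncard_image_le hf)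

end WiseGroup

open WiseGroup in
/-- **The Wise group has polynomial branching** relative to the word metric:
there exist `κ ≥ 1`, `δ ≥ 0`, a family `C = (C_z^r)` of polynomial growth,
where each `C_z^r` is a (finite) set of `(κ,δ)`-geodesic 3-paths
`(a₃, a₂, a₁)` from the identity `e` to `z` (i.e. `a₃ a₂ a₁ = z` and
`|a₁| + |a₂| + |a₃| ≤ κ |z| + δ`), and a set `𝕋` of triangles (triples
`(x, y, z)` with `x y = z`) of polynomial growth which is a retract along `C`
of the set of all triangles of `G`. -/
theorem wiseGroup_polynomial_branching :
    ∃ κ δ : ℝ, 1 ≤ κ ∧ 0 ≤ δ ∧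
    ∃ C : WiseGroup → ℕ → Finset (WiseGroup × WiseGroup × WiseGroup),
      -- each element of `C z r` is a `(κ,δ)`-geodesic 3-path from `e` to `z`
      (∀ z r, ∀ p ∈ C z r, p.1 * p.2.1 * p.2.2 = z ∧
        (wiseWordLength p.2.2 : ℝ) + wiseWordLength p.2.1 + wiseWordLength p.1 ≤
          κ * wiseWordLength z + δ) ∧
      -- the family `C` has polynomial growth
      (∃ p₁ : Polynomial ℝ, ∀ z r, ((C z r).card : ℝ) ≤ p₁.eval (r : ℝ)) ∧
      ∃ T : Set (WiseGroup × WiseGroup × WiseGroup),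
        -- `T` is a set of triangles
        (∀ t ∈ T, t.1 * t.2.1 = t.2.2) ∧
        -- `T` has polynomial growth
        (∃ p₃ : Polynomial ℝ, ∀ z : WiseGroup, ∀ r : ℝ, 0 ≤ r →
          {t ∈ T | t.2.2 = z ∧ (wiseWordLength t.1 : ℝ) ≤ r}.Finite ∧
          (({t ∈ T | t.2.2 = z ∧ (wiseWordLength t.1 : ℝ) ≤ r}.ncard : ℝ) ≤
            p₃.eval r)) ∧
        -- `T` is a retract along `C` of the set of all triangles of `G`
        (∃ p₂ : Polynomial ℝ, ∀ x y z : WiseGroup, x * y = z →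
          ∃ u v w : WiseGroup, (u, v, w) ∈ T ∧
            (wiseWordLength u : ℝ) ≤ p₂.eval (wiseWordLength x : ℝ) ∧
            ∃ a b c : WiseGroup,
              (b⁻¹, u, a) ∈ C (b⁻¹ * u * a) (wiseWordLength x) ∧
              (c⁻¹, v, b) ∈ C (c⁻¹ * v * b) (wiseWordLength x) ∧
              (c⁻¹, w, a) ∈ C (c⁻¹ * w * a) (wiseWordLength x) ∧
              b⁻¹ * u * a = x ∧ c⁻¹ * w * a = z) := by
  refine ⟨3, 0, by norm_num, le_rfl, paths, ?_, ⟨2 * Polynomial.X + 2, fun z r => ?_⟩,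
    flatTriangles, fun t ht => ht.2.2, ⟨(8 * Polynomial.X + 1) ^ 2, fun z r hr => ?_⟩,
    3 * Polynomial.X, ?_⟩
  · rintro z r p hp
    obtain ⟨U, ⟨hU, -⟩, rfl⟩ := mem_paths.1 hp
    refine ⟨by simp [pathThrough, mul_assoc], ?_⟩
    rw [add_zero]
    exact_mod_cast (pathThrough_bounds hU).2.2
  · simpa using (Nat.cast_le (α := ℝ)).2 (card_paths_le z r)
  · simpa using flatTriangles_growth z r hr
  · rintro x y z -
    obtain ⟨U, hx, hz, hxz⟩ := exists_median 1 x⁻¹ z⁻¹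
    have hy : Sep (x • U) 1 (z * x⁻¹)⁻¹ := by simpa using hxz.smul x
    have hsmul : (z * x⁻¹) • x • U = z • U := by rw [smul_smul, inv_mul_cancel_right]
    obtain ⟨hx1, hx2, hx3⟩ := pathThrough_bounds hx
    have hux := pathThrough_mid_mem_flat x U
    have hwz := pathThrough_mid_mem_flat z U
    have hv : (pathThrough x U).2.1⁻¹ * (pathThrough z U).2.1 =
        (pathThrough (z * x⁻¹) (x • U)).2.1 := by
      rw [mul_comm_of_mem_flat (inv_mem hux) hwz]
      simp [pathThrough, hsmul, mul_assoc]
    refine ⟨(pathThrough x U).2.1, (pathThrough x U).2.1⁻¹ * (pathThrough z U).2.1,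
      (pathThrough z U).2.1, ⟨hux, mul_mem (inv_mem hux) hwz, mul_inv_cancel_left _ _⟩, ?_,
      (near U)⁻¹, (near (x • U))⁻¹, (near (z • U))⁻¹, ?_, ?_, ?_, ?_, ?_⟩
    · simp only [Polynomial.eval_mul, Polynomial.eval_X, Polynomial.eval_ofNat]
      exact_mod_cast (by omega :
        wiseWordLength (pathThrough x U).2.1 ≤ 3 * wiseWordLength x)
    · have h : ((near (x • U))⁻¹)⁻¹ * (pathThrough x U).2.1 * (near U)⁻¹ = x := by
        simp [pathThrough, mul_assoc]
      rw [h]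
      exact mem_paths.2 ⟨U, ⟨hx, Or.inl hx1⟩, by simp [pathThrough]⟩
    · have h : ((near (z • U))⁻¹)⁻¹ * (pathThrough (z * x⁻¹) (x • U)).2.1 * (near (x • U))⁻¹ =
          z * x⁻¹ := by
        simp [pathThrough, hsmul, mul_assoc]
      rw [hv, h]
      exact mem_paths.2 ⟨x • U, ⟨hy, Or.inl hx2⟩, by simp [pathThrough, hsmul]⟩
    · have h : ((near (z • U))⁻¹)⁻¹ * (pathThrough z U).2.1 * (near U)⁻¹ = z := by
        simp [pathThrough, mul_assoc]
      rw [h]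
      exact mem_paths.2 ⟨U, ⟨hz, Or.inl hx1⟩, by simp [pathThrough]⟩
    · simp [pathThrough, mul_assoc]
    · simp [pathThrough, mul_assoc]
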